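/- Let k be a field with at least three elements and let n be a positive natural number. Then the normalizer in GL_n(k) of the subgroup D_n of invertible diagonal matrices is exactly the subgroup N_n of monomial matrices: a matrix g ∈ GL_n(k) satisfies g·D_n·g⁻¹ = D_n if and only if every row and every column of g has exactly one nonzero entry. -/

import Mathlib

/-- A square matrix is *monomial* if every row and every column has exactly one
nonzero entry. -/
def IsMonomialMatrix {k : Type*} [Field k] {n : ℕ} (A : Matrix (Fin n) (Fin n) k) : Prop :=
  (∀ i : Fin n, ∃! j : Fin n, A i j ≠ 0) ∧ (∀ j : Fin n, ∃! i : Fin n, A i j ≠ 0)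

namespace Matrix

variable {k : Type*} [Field k] {n : ℕ}

theorem exists_mul_diagonal_eq_diagonal_mul {A : Matrix (Fin n) (Fin n) k}
    (hA : ∀ i, ∃! j, A i j ≠ 0) (d : Fin n → k) :
    ∃ e : Fin n → k, A * diagonal d = diagonal e * A := by
  choose σ _ hσ using hA
  refine ⟨fun i => d (σ i), ?_⟩
  ext i j
  rw [mul_diagonal, diagonal_mul]
  by_cases h : A i j = 0
  · simp [h]
  · rw [hσ i j h, mul_comm]

theorem exists_diagonal_mul_eq_mul_diagonal {A : Matrix (Fin n) (Fin n) k}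
    (hA : ∀ j, ∃! i, A i j ≠ 0) (e : Fin n → k) :
    ∃ d : Fin n → k, diagonal e * A = A * diagonal d := by
  obtain ⟨d, hd⟩ := exists_mul_diagonal_eq_diagonal_mul (A := Aᵀ) hA e
  exact ⟨d, by simpa using congrArg transpose hd⟩

theorem GeneralLinearGroup.exists_row_ne_zero (g : GL (Fin n) k) (i : Fin n) :
    ∃ j, (g : Matrix (Fin n) (Fin n) k) i j ≠ 0 := by
  by_contra! h
  have hone := congrFun (congrFun g.mul_inv i) i
  simp [mul_apply, h] at hone

theorem GeneralLinearGroup.exists_col_ne_zero (g : GL (Fin n) k) (j : Fin n) :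
    ∃ i, (g : Matrix (Fin n) (Fin n) k) i j ≠ 0 := by
  by_contra! h
  have hone := congrFun (congrFun g.inv_mul j) j
  simp [mul_apply, h] at hone

/-- The diagonal matrix with entry `c` in position `j` and `1` elsewhere. -/
def diagUpdateOne (j : Fin n) (c : kˣ) : GL (Fin n) k :=
  Units.map (diagonalRingHom (Fin n) k).toMonoidHom
    (MulEquiv.piUnits.symm (Function.update 1 j c))

theorem coe_diagUpdateOne (j : Fin n) (c : kˣ) :
    (diagUpdateOne j c : Matrix (Fin n) (Fin n) k) = 1 + ((c : k) - 1) • single j j 1 := by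
  ext a b
  rcases eq_or_ne a b with rfl | hab
  · rcases eq_or_ne a j with rfl | haj
    · simp [diagUpdateOne]
    · simp [diagUpdateOne, haj, haj.symm]
  · have : ¬(j = a ∧ j = b) := fun h => hab (h.1.symm.trans h.2)
    simp [diagUpdateOne, hab, this]

theorem conj_diagUpdateOne_apply (g : GL (Fin n) k) (j : Fin n) (c : kˣ) {a b : Fin n}
    (hab : a ≠ b) :
    ((g * diagUpdateOne j c * g⁻¹ : GL (Fin n) k) : Matrix (Fin n) (Fin n) k) a b =
      ((c : k) - 1) * ((g : Matrix (Fin n) (Fin n) k) a j *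
        ((g⁻¹ : GL (Fin n) k) : Matrix (Fin n) (Fin n) k) j b) := by
  have hsingle : ((g : Matrix (Fin n) (Fin n) k) * (single j j 1 : Matrix (Fin n) (Fin n) k) *
      ((g⁻¹ : GL (Fin n) k) : Matrix (Fin n) (Fin n) k)) a b =
      (g : Matrix (Fin n) (Fin n) k) a j *
        ((g⁻¹ : GL (Fin n) k) : Matrix (Fin n) (Fin n) k) j b := by
    rw [mul_apply, Finset.sum_eq_single j]
    · simp
    · intro x _ hx
      simp [hx]
    · simp
  rw [Units.val_mul, Units.val_mul, coe_diagUpdateOne, mul_add, add_mul, mul_one, g.mul_inv,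
    add_apply, one_apply_ne hab, zero_add, mul_smul_comm, smul_mul_assoc, smul_apply, hsingle,
    smul_eq_mul]

theorem isMonomialMatrix_of_conj_isDiag {c : kˣ} (hc : (c : k) ≠ 1) (g : GL (Fin n) k)
    (h : ∀ d : GL (Fin n) k, IsDiag (d : Matrix (Fin n) (Fin n) k) →
      IsDiag ((g * d * g⁻¹ : GL (Fin n) k) : Matrix (Fin n) (Fin n) k)) :
    IsMonomialMatrix (g : Matrix (Fin n) (Fin n) k) := by
  have hzero (j : Fin n) {a b : Fin n} (hab : a ≠ b)
      (ha : (g : Matrix (Fin n) (Fin n) k) a j ≠ 0) :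
      ((g⁻¹ : GL (Fin n) k) : Matrix (Fin n) (Fin n) k) j b = 0 := by
    have hd := h (diagUpdateOne j c) (isDiag_diagonal _) hab
    beta_reduce at hd
    rw [conj_diagUpdateOne_apply g j c hab] at hd
    simpa [sub_ne_zero.mpr hc, ha] using hd
  have hcol (j : Fin n) : ∃! i, (g : Matrix (Fin n) (Fin n) k) i j ≠ 0 := by
    obtain ⟨i, hi⟩ := GeneralLinearGroup.exists_col_ne_zero g j
    obtain ⟨b, hb⟩ := GeneralLinearGroup.exists_row_ne_zero g⁻¹ j
    have heq {a : Fin n} (ha : (g : Matrix (Fin n) (Fin n) k) a j ≠ 0) : a = b := by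
      by_contra hab
      exact hb (hzero j hab ha)
    exact ⟨i, hi, fun a ha => (heq ha).trans (heq hi).symm⟩
  refine ⟨fun i => ?_, hcol⟩
  choose τ _ hτ using hcol
  have hsurj : Function.Surjective τ := fun i => by
    obtain ⟨j, hj⟩ := GeneralLinearGroup.exists_row_ne_zero g i
    exact ⟨j, (hτ j i hj).symm⟩
  obtain ⟨j, hj⟩ := GeneralLinearGroup.exists_row_ne_zero g i
  exact ⟨j, hj, fun j' hj' =>
    Finite.injective_iff_surjective.mpr hsurj ((hτ j' i hj').symm.trans (hτ j i hj))⟩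

theorem isDiag_conj_iff_of_isMonomialMatrix {g : GL (Fin n) k}
    (hg : IsMonomialMatrix (g : Matrix (Fin n) (Fin n) k)) (d : GL (Fin n) k) :
    IsDiag ((g * d * g⁻¹ : GL (Fin n) k) : Matrix (Fin n) (Fin n) k) ↔
      IsDiag (d : Matrix (Fin n) (Fin n) k) := by
  constructor
  · intro h
    obtain ⟨e, he⟩ := exists_diagonal_mul_eq_mul_diagonal hg.2 (diag _)
    rw [h.diagonal_diag, ← Units.val_mul, inv_mul_cancel_right, Units.val_mul] at he
    rw [g.isUnit.mul_left_cancel he]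
    exact isDiag_diagonal e
  · intro h
    obtain ⟨e, he⟩ := exists_mul_diagonal_eq_diagonal_mul hg.1 (diag _)
    rw [h.diagonal_diag] at he
    rw [Units.val_mul, Units.val_mul, he, mul_assoc, g.mul_inv, mul_one]
    exact isDiag_diagonal e

end Matrix

theorem exists_unit_ne_one_of_three_le_mk {k : Type*} [Field k] (hk : 3 ≤ Cardinal.mk k) :
    ∃ c : kˣ, (c : k) ≠ 1 := by
  obtain ⟨c, hc0, hc1⟩ := Cardinal.exists_ne_ne_of_three_le hk 0 1
  exact ⟨Units.mk0 c hc0, hc1⟩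

/-- Let `k` be a field with at least three elements and `n` a positive
natural number.  The normalizer in `GL n k` of the subgroup `D_n` of invertible diagonal
matrices is exactly the subgroup of monomial matrices: `g ∈ GL n k` satisfies
`g ⬝ D_n ⬝ g⁻¹ = D_n` iff every row and every column of `g` has exactly one nonzero
entry. -/
theorem normalizer_of_diagonal_eq_monomial (k : Type*) [Field k]
    (hk : 3 ≤ Cardinal.mk k) (n : ℕ) (hn : 0 < n) (g : GL (Fin n) k) :
    (fun d : GL (Fin n) k => g * d * g⁻¹) ''
        {d : GL (Fin n) k | Matrix.IsDiag (d : Matrix (Fin n) (Fin n) k)} =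
      {d : GL (Fin n) k | Matrix.IsDiag (d : Matrix (Fin n) (Fin n) k)} ↔
    IsMonomialMatrix (g : Matrix (Fin n) (Fin n) k) := by
  constructor
  · intro h
    obtain ⟨c, hc⟩ := exists_unit_ne_one_of_three_le_mk hk
    exact Matrix.isMonomialMatrix_of_conj_isDiag hc g fun d hd =>
      h.subset (Set.mem_image_of_mem _ hd)
  · intro hg
    ext e
    constructor
    · rintro ⟨d, hd, rfl⟩
      exact (Matrix.isDiag_conj_iff_of_isMonomialMatrix hg d).mpr hd
    · intro he
      have hconj : g * (g⁻¹ * e * g) * g⁻¹ = e := by group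
      refine ⟨g⁻¹ * e * g, (Matrix.isDiag_conj_iff_of_isMonomialMatrix hg _).mp ?_, hconj⟩
      rwa [hconj]
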